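/- arXiv:0805.3788 — 3 statements merged into one kernel-verified Lean document; each statement's English description precedes it below -/
import Mathlib

section
/- Let T be a subset of the positive rationals such that 1 ∈ T, every element of T is ≥ 1, and for every positive integer y the set T ∩ [y, y+1) is finite with cardinality strictly greater than y^y. Let U be the subsemigroup of (ℚ,+) generated by T. Then there is no noetherian local domain R (with maximal ideal m_R) and valuation ν of the fraction field of R with values in (ℝ,+) dominating R such that ν(m_R∖{0}) = U (as subsets of ℝ). -/
/-- If a maximal ideal `I` is generated by `d` elements, then the length of `R ⧸ I ^ (n + 1)` is at
most `d` times the length of `R ⧸ I ^ n`, plus one. -/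
lemma Ideal.length_quotient_pow_succ_le {R : Type*} [CommRing R] (I : Ideal R) [hI : I.IsMaximal]
    {d : ℕ} (x : Fin d → R) (hx : Ideal.span (Set.range x) = I) (n : ℕ) :
    Module.length R (R ⧸ I ^ (n + 1)) ≤ d * Module.length R (R ⧸ I ^ n) + 1 := by
  have hxI : ∀ i, x i ∈ I := fun i => hx ▸ Ideal.subset_span ⟨i, rfl⟩
  have hmul : ∀ i, I ^ n ≤ Submodule.comap (LinearMap.mulLeft R (x i)) (I ^ (n + 1)) := fun i r hr => by
    simpa [pow_succ'] using Ideal.mul_mem_mul (hxI i) hr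
  let f : (Fin d → R ⧸ I ^ n) →ₗ[R] R ⧸ I ^ (n + 1) :=
    ∑ i, (Submodule.mapQ (I ^ n) (I ^ (n + 1)) (LinearMap.mulLeft R (x i)) (hmul i)).comp
      (LinearMap.proj i)
  let g : (R ⧸ I ^ (n + 1)) →ₗ[R] R ⧸ I :=
    Submodule.factor (Ideal.pow_le_self n.succ_ne_zero)
  have hg : Function.Surjective g := Submodule.factor_surjective _
  have hker : LinearMap.ker g ≤ LinearMap.range f := by
    intro z hz
    obtain ⟨r, rfl⟩ := Submodule.Quotient.mk_surjective _ z
    have hr : r ∈ Ideal.span (Set.range x) := by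
      rw [hx]
      exact (Submodule.Quotient.mk_eq_zero I).mp hz
    obtain ⟨c, rfl⟩ := Ideal.mem_span_range_iff_exists_fun.mp hr
    refine ⟨fun i => Submodule.Quotient.mk (c i), ?_⟩
    simp only [f, LinearMap.sum_apply, LinearMap.comp_apply, LinearMap.proj_apply]
    rw [← Submodule.mkQ_apply, map_sum]
    refine Finset.sum_congr rfl fun i _ => ?_
    rw [mul_comm (c i)]
    rfl
  have hsimple : IsSimpleModule R (R ⧸ I) :=
    isSimpleModule_iff_isCoatom.mpr hI.out
  rw [Module.length_eq_add_of_exact (LinearMap.ker g).subtype g (Submodule.subtype_injective _) hg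
    (LinearMap.exact_subtype_ker_map g), Module.length_eq_one R (R ⧸ I)]
  gcongr
  calc Module.length R (LinearMap.ker g)
      ≤ Module.length R (LinearMap.range f) :=
        Module.length_le_of_injective (Submodule.inclusion hker) (Submodule.inclusion_injective _)
    _ ≤ Module.length R (Fin d → R ⧸ I ^ n) :=
        Module.length_le_of_surjective f.rangeRestrict f.surjective_rangeRestrict
    _ = d * Module.length R (R ⧸ I ^ n) := by
        rw [Module.length_pi, ENat.card_eq_coe_fintype_card, Fintype.card_fin]

lemma Ideal.length_quotient_pow_add_one_le {R : Type*} [CommRing R] (I : Ideal R) [I.IsMaximal]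
    {d : ℕ} (x : Fin d → R) (hx : Ideal.span (Set.range x) = I) (n : ℕ) :
    Module.length R (R ⧸ I ^ n) + 1 ≤ ((d + 2) ^ n : ℕ) := by
  induction n with
  | zero =>
    have : Subsingleton (R ⧸ I ^ 0) := by
      rw [pow_zero, Ideal.one_eq_top]
      infer_instance
    simp [Module.length_eq_zero]
  | succ n ih =>
    calc Module.length R (R ⧸ I ^ (n + 1)) + 1
        ≤ d * Module.length R (R ⧸ I ^ n) + 1 + 1 := by
          gcongr
          exact I.length_quotient_pow_succ_le x hx n
      _ ≤ (d + 2) * (Module.length R (R ⧸ I ^ n) + 1) := by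
          rw [add_mul, mul_add, two_mul, add_assoc]
          exact add_le_add le_self_add (add_le_add le_add_self le_add_self)
      _ ≤ (d + 2) * ((d + 2) ^ n : ℕ) := by gcongr
      _ = ((d + 2) ^ (n + 1) : ℕ) := by push_cast; ring

/-- The ideal of elements of value at least `γ`. -/
def valueIdeal {R : Type*} [CommRing R] [IsDomain R] (v : R → ℝ)
    (hmul : ∀ x y : R, x ≠ 0 → y ≠ 0 → v (x * y) = v x + v y)
    (hadd : ∀ x y : R, x ≠ 0 → y ≠ 0 → x + y ≠ 0 → min (v x) (v y) ≤ v (x + y))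
    (hnonneg : ∀ x : R, x ≠ 0 → 0 ≤ v x) (γ : ℝ) : Ideal R where
  carrier := {x | x ≠ 0 → γ ≤ v x}
  zero_mem' h := absurd rfl h
  add_mem' {x y} hx hy hxy := by
    by_cases hx0 : x = 0
    · subst hx0
      simp only [zero_add] at hxy ⊢
      exact hy hxy
    by_cases hy0 : y = 0
    · subst hy0
      simp only [add_zero] at hxy ⊢
      exact hx hxy
    exact (le_min (hx hx0) (hy hy0)).trans (hadd x y hx0 hy0 hxy)
  smul_mem' r x hx hrx := by
    have hr0 : r ≠ 0 := left_ne_zero_of_mul hrx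
    have hx0 : x ≠ 0 := right_ne_zero_of_mul hrx
    rw [smul_eq_mul, hmul r x hr0 hx0]
    linarith [hnonneg r hr0, hx hx0]

/-- A valuation with values at least `1` on `I` takes at most `length (R ⧸ I ^ n) + 1` values
in `(-∞, n]`. -/
lemma card_values_le_length_add_one {R : Type*} [CommRing R] [IsDomain R] (v : R → ℝ)
    (hmul : ∀ x y : R, x ≠ 0 → y ≠ 0 → v (x * y) = v x + v y)
    (hadd : ∀ x y : R, x ≠ 0 → y ≠ 0 → x + y ≠ 0 → min (v x) (v y) ≤ v (x + y))
    (hnonneg : ∀ x : R, x ≠ 0 → 0 ≤ v x) (I : Ideal R)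
    (hI : ∀ x ∈ I, x ≠ 0 → 1 ≤ v x) (n : ℕ) (S : Finset ℝ)
    (hS : ∀ s ∈ S, s ≤ n ∧ ∃ x, x ≠ 0 ∧ v x = s) :
    (S.card : ℕ∞) ≤ Module.length R (R ⧸ I ^ n) + 1 := by
  let J := valueIdeal v hmul hadd hnonneg
  have hpow : ∀ k : ℕ, I ^ k ≤ J k := by
    intro k
    induction k with
    | zero =>
      intro x _ hx
      simpa using hnonneg x hx
    | succ k ih =>
      rw [pow_succ, Ideal.mul_le]
      intro a ha b hb hab
      have ha0 := left_ne_zero_of_mul hab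
      have hb0 := right_ne_zero_of_mul hab
      rw [hmul a b ha0 hb0]
      push_cast
      linarith [ih ha ha0, hI b hb hb0]
  obtain hzero | ⟨N, hN⟩ : S.card = 0 ∨ ∃ N, S.card = N + 1 := by
    cases h : S.card <;> simp
  · simp [hzero]
  let e := S.orderEmbOfFin hN
  have he : ∀ i, e i ∈ S := S.orderEmbOfFin_mem hN
  let p : LTSeries (Ideal R) := LTSeries.mk N (fun i => J (e i.rev)) (by
    intro i j hij
    have hlt : e j.rev < e i.rev := e.strictMono (Fin.rev_lt_rev.mpr hij)
    refine lt_of_le_not_ge (fun x hx hx0 => hlt.le.trans (hx hx0)) (fun hle => ?_)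
    obtain ⟨x, hx0, hx⟩ := (hS _ (he j.rev)).2
    have hmem : x ∈ J (e j.rev) := fun _ => hx.ge
    exact absurd ((hle hmem hx0).trans_eq hx) hlt.not_ge)
  have hp : I ^ n ≤ p.head := fun x hx hx0 => (hS _ (he _)).1.trans (hpow n hx hx0)
  have hlen := Order.length_le_coheight hp
  rw [Module.length_quotient, hN]
  push_cast
  gcongr
  exact hlen


/-- Let `T ⊆ ℚ_{>0}` with `1 ∈ T`, all elements `≥ 1`, and for every positive
integer `y` the set `T ∩ [y, y+1)` finite of cardinality `> y^y`, and let `U` be the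
subsemigroup of `(ℚ,+)` generated by `T`.  Then there is no noetherian local domain `R` with a
real-valued valuation `ν` of its fraction field dominating `R` such that `ν(m_R∖{0}) = U`
(viewed in `ℝ`); equivalently, for every such `R` and `ν`, `ν(m_R∖{0}) ≠ U`. -/
theorem stmt3 (T : Set ℚ)
    (hTpos : ∀ q ∈ T, 0 < q)
    (h1T : (1 : ℚ) ∈ T)
    (hge1 : ∀ q ∈ T, 1 ≤ q)
    (hcount : ∀ y : ℕ, 0 < y →
      {q : ℚ | q ∈ T ∧ (y : ℚ) ≤ q ∧ q < (y : ℚ) + 1}.Finite ∧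
      y ^ y < {q : ℚ | q ∈ T ∧ (y : ℚ) ≤ q ∧ q < (y : ℚ) + 1}.ncard)
    (R : Type*) [CommRing R] [IsDomain R] [IsNoetherianRing R] [IsLocalRing R]
    (K : Type*) [Field K] [Algebra R K] [IsFractionRing R K]
    (ν : K → ℝ)
    (hmul : ∀ x y : K, x ≠ 0 → y ≠ 0 → ν (x * y) = ν x + ν y)
    (hadd : ∀ x y : K, x ≠ 0 → y ≠ 0 → x + y ≠ 0 → min (ν x) (ν y) ≤ ν (x + y))
    (hnonneg : ∀ x : R, x ≠ 0 → 0 ≤ ν (algebraMap R K x))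
    (hdom : ∀ x : R, x ∈ IsLocalRing.maximalIdeal R → x ≠ 0 → 0 < ν (algebraMap R K x)) :
    {r : ℝ | ∃ x : R, x ∈ IsLocalRing.maximalIdeal R ∧ x ≠ 0 ∧ ν (algebraMap R K x) = r}
      ≠ (Rat.cast '' (AddSubsemigroup.closure T : Set ℚ) : Set ℝ) := by
  intro hU
  set m := IsLocalRing.maximalIdeal R with hm
  let v : R → ℝ := fun x => ν (algebraMap R K x)
  have hinj := IsFractionRing.injective R K
  have hne : ∀ x : R, x ≠ 0 → algebraMap R K x ≠ 0 := fun x hx =>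
    (map_ne_zero_iff _ hinj).mpr hx
  have hvmul : ∀ x y : R, x ≠ 0 → y ≠ 0 → v (x * y) = v x + v y := fun x y hx hy => by
    simp only [v, map_mul]
    exact hmul _ _ (hne x hx) (hne y hy)
  have hvadd : ∀ x y : R, x ≠ 0 → y ≠ 0 → x + y ≠ 0 → min (v x) (v y) ≤ v (x + y) :=
    fun x y hx hy hxy => by
      have h := hne _ hxy
      simp only [v, map_add] at h ⊢
      exact hadd _ _ (hne x hx) (hne y hy) h
  have hUge : ∀ q ∈ AddSubsemigroup.closure T, 1 ≤ q := fun q hq => by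
    induction hq using AddSubsemigroup.closure_induction with
    | mem x hx => exact hge1 x hx
    | add x y _ _ hx hy => linarith
  have hm1 : ∀ x ∈ m, x ≠ 0 → 1 ≤ v x := fun x hx hx0 => by
    have hmem : v x ∈ (Rat.cast '' (AddSubsemigroup.closure T : Set ℚ) : Set ℝ) :=
      hU ▸ ⟨x, hx, hx0, rfl⟩
    obtain ⟨q, hq, hqx⟩ := hmem
    rw [← hqx]
    exact_mod_cast hUge q hq
  obtain ⟨d, x, hx⟩ := Submodule.fg_iff_exists_fin_generating_family.mp
    (IsNoetherian.noetherian m)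
  set D := d + 2 with hD
  obtain ⟨hfin, hcard⟩ := hcount (D ^ 2) (by positivity)
  let S : Finset ℝ := hfin.toFinset.map ⟨Rat.cast, Rat.cast_injective⟩
  have hScard : (D ^ 2) ^ (D ^ 2) < S.card := by
    rwa [Finset.card_map, ← Set.ncard_eq_toFinset_card _ hfin]
  have hS : ∀ s ∈ S, s ≤ (D ^ 2 + 1 : ℕ) ∧ ∃ x, x ≠ 0 ∧ v x = s := by
    intro s hs
    obtain ⟨q, hq, rfl⟩ := Finset.mem_map.mp hs
    obtain ⟨hqT, -, hlt⟩ := hfin.mem_toFinset.mp hq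
    refine ⟨?_, ?_⟩
    · have hle : q ≤ ((D ^ 2 + 1 : ℕ) : ℚ) := by push_cast at hlt ⊢; exact hlt.le
      change (q : ℝ) ≤ _
      exact_mod_cast hle
    · have hmem : (q : ℝ) ∈ (Rat.cast '' (AddSubsemigroup.closure T : Set ℚ) : Set ℝ) :=
        ⟨q, AddSubsemigroup.subset_closure hqT, rfl⟩
      rw [← hU] at hmem
      obtain ⟨y, -, hy0, hy⟩ := hmem
      exact ⟨y, hy0, hy⟩
  have hle : S.card ≤ D ^ (D ^ 2 + 1) := by
    have := (card_values_le_length_add_one v hvmul hvadd hnonneg m hm1 (D ^ 2 + 1) S hS).trans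
      (m.length_quotient_pow_add_one_le x hx (D ^ 2 + 1))
    exact_mod_cast this
  have hpow : D ^ (D ^ 2 + 1) ≤ (D ^ 2) ^ (D ^ 2) := by
    rw [← pow_mul]
    refine Nat.pow_le_pow_right (by omega) ?_
    nlinarith [Nat.one_le_pow 2 D (by omega)]
  omega
end

section
/- Let R be a noetherian local domain, let A and B be subgroups of (ℝ,+), and let ν be a valuation of the fraction field of R with values in Γ = A × B ordered lexicographically, nonnegative on R. Let π : Γ → A be the first projection and ν₂ = π∘ν. Suppose the centers coincide: p := {x ∈ R : ν(x) > 0} = {x ∈ R : ν₂(x) > 0}. Then for every φ₂ ∈ ν₂(R∖{0}), the set {φ ∈ ν(R∖{0}) : π(φ) = φ₂} is finite, and its cardinality is at most the length of the R_p-module (Q_{φ₂}/Q_{φ₂}⁺) ⊗_R R_p, which is finite. -/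
/-- The valuation ideal of elements of value at least `γ`, for a function `v` satisfying the axioms
of a valuation on nonzero elements. -/
def valuationIdeal {R Γ : Type*} [CommRing R] [IsDomain R] [AddCommGroup Γ] [LinearOrder Γ]
    [IsOrderedAddMonoid Γ] (v : R → Γ)
    (hmul : ∀ x y : R, x ≠ 0 → y ≠ 0 → v (x * y) = v x + v y)
    (hadd : ∀ x y : R, x ≠ 0 → y ≠ 0 → x + y ≠ 0 → min (v x) (v y) ≤ v (x + y))
    (hnonneg : ∀ x : R, x ≠ 0 → 0 ≤ v x) (γ : Γ) : Ideal R where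
  carrier := {x | x = 0 ∨ γ ≤ v x}
  zero_mem' := Or.inl rfl
  add_mem' := by
    intro x y hx hy
    by_cases hx0 : x = 0
    · simpa [hx0] using hy
    by_cases hy0 : y = 0
    · simpa [hy0] using hx
    by_cases hxy : x + y = 0
    · exact Or.inl hxy
    · exact Or.inr ((le_min (hx.resolve_left hx0) (hy.resolve_left hy0)).trans
        (hadd x y hx0 hy0 hxy))
  smul_mem' := by
    intro r x hx
    by_cases hr0 : r = 0
    · exact Or.inl (by simp [hr0])
    by_cases hx0 : x = 0
    · exact Or.inl (by simp [hx0])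
    · refine Or.inr ?_
      rw [smul_eq_mul, hmul r x hr0 hx0]
      exact (hx.resolve_left hx0).trans (le_add_of_nonneg_left (hnonneg r hr0))

/-- A finitely generated module over a noetherian local ring has finite length as soon as it is
annihilated by a power of the maximal ideal. -/
lemma isFiniteLength_of_maximalIdeal_pow_le_annihilator {R M : Type*} [CommRing R]
    [IsNoetherianRing R] [IsLocalRing R] [AddCommGroup M] [Module R M] [Module.Finite R M]
    (n : ℕ) (h : IsLocalRing.maximalIdeal R ^ n ≤ Module.annihilator R M) :
    IsFiniteLength R M := by
  rw [isFiniteLength_iff_isNoetherian_isArtinian]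
  refine ⟨inferInstance, ?_⟩
  set I := Module.annihilator R M with hI
  have : Ring.KrullDimLE 0 (R ⧸ I) := Ring.krullDimLE_zero_iff.mpr fun J prime ↦
    Ideal.isMaximal_of_isIntegral_of_isMaximal_comap (R := R) _ <| by
      have hJ := prime.comap (Ideal.Quotient.mk I)
      have hle : IsLocalRing.maximalIdeal R ≤ J.comap (Ideal.Quotient.mk I) :=
        hJ.le_of_pow_le (h.trans (le_trans (by simp) (Ideal.ker_le_comap _)))
      have heq := le_antisymm (IsLocalRing.le_maximalIdeal hJ.1) hle
      change (J.comap (Ideal.Quotient.mk I)).IsMaximal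
      rw [heq]
      exact IsLocalRing.maximalIdeal.isMaximal R
  have : IsArtinianRing (R ⧸ I) := IsNoetherianRing.isArtinianRing_of_krullDimLE_zero
  have ht : Module.IsTorsionBySet R M I :=
    (Module.isTorsionBySet_iff_subset_annihilator ..).mpr subset_rfl
  let _ := ht.module
  have hb := ht.semilinearMap.finite_iff_of_bijective Function.bijective_id
  have : Module.Finite (R ⧸ I) M := hb.mp inferInstance
  exact (ht.semilinearMap.isArtinian_iff_of_bijective Function.bijective_id).mpr inferInstance

lemma map_annihilator_le_annihilator_localizedModule {R M : Type*} [CommRing R] [AddCommGroup M]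
    [Module R M] (S : Submonoid R) :
    (Module.annihilator R M).map (algebraMap R (Localization S)) ≤
      Module.annihilator (Localization S) (LocalizedModule S M) := by
  rw [Ideal.map_le_iff_le_comap]
  intro r hr
  rw [Ideal.mem_comap, Module.mem_annihilator]
  intro m
  induction m using LocalizedModule.induction_on with
  | h m s =>
    rw [algebraMap_smul, LocalizedModule.smul'_mk, Module.mem_annihilator.mp hr,
      LocalizedModule.zero_mk]

/-- A family in a partial order with bottom that is strictly antitone on a finite set and avoids
`⊥` there bounds the cardinality of that set by the Krull dimension. -/
lemma card_le_krullDim_of_strictAntiOn {Γ L : Type*} [LinearOrder Γ] [PartialOrder L] [OrderBot L]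
    (f : Γ → L) (T : Finset Γ) (hf : StrictAntiOn f T) (hbot : ∀ γ ∈ T, f γ ≠ ⊥) :
    (T.card : WithBot ℕ∞) ≤ Order.krullDim L := by
  let e := T.orderEmbOfFin rfl
  have he (i) : e i ∈ T := T.orderEmbOfFin_mem rfl i
  let g : Fin (T.card + 1) → L := Fin.cases ⊥ fun i ↦ f (e i.rev)
  have hg : StrictMono g := by
    intro i j hij
    induction j using Fin.cases with
    | zero => exact absurd hij (Fin.not_lt_zero i)
    | succ j =>
      induction i using Fin.cases with
      | zero => exact bot_lt_iff_ne_bot.mpr (hbot _ (he _))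
      | succ i =>
        exact hf (he _) (he _) (e.strictMono (Fin.rev_lt_rev.mpr (Fin.succ_lt_succ_iff.mp hij)))
  exact Order.LTSeries.length_le_krullDim (LTSeries.mk T.card g hg)

lemma mkLinearMap_mem_localized_iff {R M : Type*} [CommRing R] [AddCommGroup M] [Module R M]
    (S : Submonoid R) (N : Submodule R M) (m : M) :
    LocalizedModule.mkLinearMap S M m ∈ N.localized S ↔ ∃ s : S, s • m ∈ N := by
  rw [Submodule.localized, Submodule.mem_localized']
  constructor
  · rintro ⟨n, hn, s, h⟩
    rw [← IsLocalizedModule.mk'_one S, IsLocalizedModule.mk'_eq_mk'_iff] at h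
    obtain ⟨u, hu⟩ := h
    refine ⟨u * s, ?_⟩
    rw [mul_smul, hu, one_smul]
    exact N.smul_mem _ hn
  · rintro ⟨s, hs⟩
    refine ⟨_, hs, s, ?_⟩
    rw [IsLocalizedModule.mk'_eq_iff, LinearMap.map_smul_of_tower]

/-- If a prime ideal of a noetherian domain is the center of a real valuation, then its powers have
arbitrarily large values. -/
lemma exists_pow_center_le {R : Type*} [CommRing R] [IsDomain R] [IsNoetherianRing R] (v : R → ℝ)
    (hmul : ∀ x y : R, x ≠ 0 → y ≠ 0 → v (x * y) = v x + v y)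
    (hadd : ∀ x y : R, x ≠ 0 → y ≠ 0 → x + y ≠ 0 → min (v x) (v y) ≤ v (x + y))
    (hnonneg : ∀ x : R, x ≠ 0 → 0 ≤ v x) (p : Ideal R)
    (hp : ∀ x ∈ p, x = 0 ∨ 0 < v x) (a : ℝ) :
    ∃ n : ℕ, p ^ n ≤ valuationIdeal v hmul hadd hnonneg a := by
  obtain ⟨s, hs⟩ := (IsNoetherian.noetherian p : p.FG)
  have hc : ∃ c > 0, ∀ x ∈ s, x = 0 ∨ c ≤ v x := by
    have hsp : ∀ x ∈ s, x = 0 ∨ 0 < v x := fun x hx ↦ hp x (hs ▸ Ideal.subset_span hx)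
    clear hs
    classical
    induction s using Finset.induction_on with
    | empty => exact ⟨1, one_pos, by simp⟩
    | insert x s _ ih =>
      obtain ⟨c, hc, h⟩ := ih fun y hy ↦ hsp y (Finset.mem_insert_of_mem hy)
      rcases hsp x (Finset.mem_insert_self x s) with hx | hx
      · exact ⟨c, hc, by simpa [hx] using h⟩
      · refine ⟨min c (v x), lt_min hc hx, fun y hy ↦ ?_⟩
        rcases Finset.mem_insert.mp hy with rfl | hy
        · exact Or.inr (min_le_right ..)
        · exact (h y hy).imp_right (min_le_left ..).trans
  obtain ⟨c, hc, h⟩ := hc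
  have hpc : p ≤ valuationIdeal v hmul hadd hnonneg c := by
    rw [← hs]
    exact Ideal.span_le.mpr h
  have hpow (n : ℕ) : p ^ n ≤ valuationIdeal v hmul hadd hnonneg (n * c) := by
    induction n with
    | zero =>
      intro x _
      by_cases hx : x = 0
      · exact Or.inl hx
      · exact Or.inr (by simpa using hnonneg x hx)
    | succ n ih =>
      rw [pow_succ, Ideal.mul_le]
      intro x hx y hy
      by_cases hx0 : x = 0
      · exact Or.inl (by simp [hx0])
      by_cases hy0 : y = 0
      · exact Or.inl (by simp [hy0])
      refine Or.inr ?_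
      rw [hmul x y hx0 hy0]
      have h1 := (ih hx).resolve_left hx0
      have h2 := (hpc hy).resolve_left hy0
      push_cast
      linarith
  obtain ⟨n, hn⟩ := exists_nat_ge (a / c)
  refine ⟨n, (hpow n).trans fun x hx ↦ hx.imp_right fun h ↦ le_trans ?_ h⟩
  rwa [div_le_iff₀ hc] at hn


/-- The length of a module, i.e. the supremum of lengths of chains of submodules,
realized as the Krull dimension of the lattice of submodules. -/
noncomputable def moduleLength (R M : Type*) [Ring R] [AddCommGroup M] [Module R M] :
    WithBot ℕ∞ :=
  Order.krullDim (Submodule R M)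

/-- `R` a noetherian local domain, `ν` a valuation of its fraction field with
values in `A × B ⊆ ℝ ×ₗ ℝ` (lex), nonnegative on `R`, `ν₂ = π ∘ ν`, and suppose the centers of
`ν` and `ν₂` coincide, `p`.  Then for every `φ₂ ∈ ν₂(R∖{0})` the fibre
`{φ ∈ ν(R∖{0}) : π(φ) = φ₂}` is finite, of cardinality at most the length of the
`R_p`-module `(Q_{φ₂}/Q_{φ₂}⁺) ⊗_R R_p`, which is finite. -/
theorem stmt6 (R : Type*) [CommRing R] [IsDomain R] [IsNoetherianRing R] [IsLocalRing R]
    (K : Type*) [Field K] [Algebra R K] [IsFractionRing R K]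
    (A B : AddSubgroup ℝ)
    (ν : K → ℝ ×ₗ ℝ)
    (hval : ∀ x : K, x ≠ 0 → (ofLex (ν x)).1 ∈ A ∧ (ofLex (ν x)).2 ∈ B)
    (hmul : ∀ x y : K, x ≠ 0 → y ≠ 0 → ν (x * y) = ν x + ν y)
    (hadd : ∀ x y : K, x ≠ 0 → y ≠ 0 → x + y ≠ 0 → min (ν x) (ν y) ≤ ν (x + y))
    (hnonneg : ∀ x : R, x ≠ 0 → 0 ≤ ν (algebraMap R K x))
    (p : Ideal R) [p.IsPrime]
    (hp : ∀ x : R, x ∈ p ↔ (x = 0 ∨ 0 < ν (algebraMap R K x)))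
    (hpcoincide : ∀ x : R, x ∈ p ↔ (x = 0 ∨ 0 < (ofLex (ν (algebraMap R K x))).1))
    (φ₂ : ℝ)
    (hφ₂ : ∃ x : R, x ≠ 0 ∧ (ofLex (ν (algebraMap R K x))).1 = φ₂)
    (Q Qplus : Ideal R)
    (hQ : ∀ x : R, x ∈ Q ↔ (x = 0 ∨ φ₂ ≤ (ofLex (ν (algebraMap R K x))).1))
    (hQplus : ∀ x : R, x ∈ Qplus ↔ (x = 0 ∨ φ₂ < (ofLex (ν (algebraMap R K x))).1)) :
    {γ : ℝ ×ₗ ℝ | (∃ x : R, x ≠ 0 ∧ ν (algebraMap R K x) = γ) ∧ (ofLex γ).1 = φ₂}.Finite ∧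
    ({γ : ℝ ×ₗ ℝ | (∃ x : R, x ≠ 0 ∧ ν (algebraMap R K x) = γ) ∧
        (ofLex γ).1 = φ₂}.ncard : WithBot ℕ∞)
      ≤ moduleLength (Localization p.primeCompl)
          (LocalizedModule p.primeCompl (Q ⧸ (Submodule.comap Q.subtype Qplus))) ∧
    moduleLength (Localization p.primeCompl)
        (LocalizedModule p.primeCompl (Q ⧸ (Submodule.comap Q.subtype Qplus))) < ⊤ := by
  have hinj {x : R} (hx : x ≠ 0) : algebraMap R K x ≠ 0 :=
    (map_ne_zero_iff _ (IsFractionRing.injective R K)).mpr hx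
  let v : R → ℝ ×ₗ ℝ := fun x ↦ ν (algebraMap R K x)
  have vmul (x y : R) (hx : x ≠ 0) (hy : y ≠ 0) : v (x * y) = v x + v y := by
    simp only [v, map_mul, hmul _ _ (hinj hx) (hinj hy)]
  have vadd (x y : R) (hx : x ≠ 0) (hy : y ≠ 0) (hxy : x + y ≠ 0) :
      min (v x) (v y) ≤ v (x + y) := by
    simpa only [v, map_add] using
      hadd _ _ (hinj hx) (hinj hy) (by simpa only [map_add] using hinj hxy)
  have fst_mono : Monotone fun γ : ℝ ×ₗ ℝ ↦ (ofLex γ).1 := Prod.Lex.monotone_fst_ofLex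
  let v₂ : R → ℝ := fun x ↦ (ofLex (v x)).1
  have v₂mul (x y : R) (hx : x ≠ 0) (hy : y ≠ 0) : v₂ (x * y) = v₂ x + v₂ y := by
    simp [v₂, vmul x y hx hy]
  have v₂add (x y : R) (hx : x ≠ 0) (hy : y ≠ 0) (hxy : x + y ≠ 0) :
      min (v₂ x) (v₂ y) ≤ v₂ (x + y) := by
    rw [← fst_mono.map_min]
    exact fst_mono (vadd x y hx hy hxy)
  have v₂nonneg (x : R) (hx : x ≠ 0) : 0 ≤ v₂ x := fst_mono (hnonneg x hx)
  let M := Q ⧸ (Submodule.comap Q.subtype Qplus)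
  have hlen : IsFiniteLength (Localization p.primeCompl) (LocalizedModule p.primeCompl M) := by
    obtain ⟨n, hn⟩ := exists_pow_center_le v₂ v₂mul v₂add v₂nonneg p
      (fun x hx ↦ (hpcoincide x).mp hx) (φ₂ + 1)
    have hann : p ^ n ≤ Module.annihilator R M := by
      intro r hr
      rw [Module.mem_annihilator]
      intro m
      obtain ⟨q, rfl⟩ := Submodule.Quotient.mk_surjective _ m
      rw [← Submodule.Quotient.mk_smul, Submodule.Quotient.mk_eq_zero, Submodule.mem_comap]
      have hrQ : r ∈ Qplus :=
        (hQplus r).mpr ((hn hr).imp_right fun h ↦ (lt_add_one φ₂).trans_le h)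
      simpa using Qplus.mul_mem_right (q : R) hrQ
    have : IsLocalRing (Localization p.primeCompl) :=
      inferInstanceAs (IsLocalRing (Localization.AtPrime p))
    have : IsNoetherianRing (Localization p.primeCompl) :=
      IsLocalization.isNoetherianRing p.primeCompl _ inferInstance
    refine isFiniteLength_of_maximalIdeal_pow_le_annihilator n (le_trans ?_
      (map_annihilator_le_annihilator_localizedModule p.primeCompl))
    have hmax : p.map (algebraMap R (Localization p.primeCompl)) =
        IsLocalRing.maximalIdeal (Localization p.primeCompl) :=
      Localization.AtPrime.map_eq_maximalIdeal
    rw [← hmax, ← Ideal.map_pow]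
    exact Ideal.map_mono hann
  have hfin : moduleLength (Localization p.primeCompl) (LocalizedModule p.primeCompl M) < ⊤ := by
    have := Module.length_ne_top_iff.mpr hlen
    rw [moduleLength, ← Module.coe_length]
    exact WithBot.coe_lt_coe.mpr this.lt_top
  let N (γ : ℝ ×ₗ ℝ) : Submodule R M :=
    Submodule.map (Submodule.mkQ _)
      (Submodule.comap Q.subtype (valuationIdeal v vmul vadd hnonneg γ))
  set F : Set (ℝ ×ₗ ℝ) :=
    {γ | (∃ x : R, x ≠ 0 ∧ ν (algebraMap R K x) = γ) ∧ (ofLex γ).1 = φ₂} with hF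
  have hcard (T : Finset (ℝ ×ₗ ℝ)) (hT : (T : Set _) ⊆ F) : (T.card : WithBot ℕ∞) ≤
      moduleLength (Localization p.primeCompl) (LocalizedModule p.primeCompl M) := by
    have key (x : R) (hx : x ≠ 0) (hxφ : v₂ x = φ₂) (s : p.primeCompl) (z : R)
        (hz : z = 0 ∨ v x < v z) : (s : R) * x - z ∉ Qplus := by
      have hs0 : (s : R) ≠ 0 := fun h ↦ s.2 (h ▸ p.zero_mem)
      have hvs : v s = 0 := le_antisymm
        (not_lt.mp fun h ↦ s.2 ((hp s).mpr (Or.inr h))) (hnonneg s hs0)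
      have hvsx : v (s * x) = v x := by rw [vmul _ _ hs0 hx, hvs, zero_add]
      intro hmem
      have hlt : (s : R) * x - z = 0 ∨ v x < v (s * x - z) := by
        refine ((hQplus _).mp hmem).imp_right fun h ↦ ?_
        exact fst_mono.reflect_lt (hxφ.trans_lt h)
      have hsx0 := mul_ne_zero hs0 hx
      rcases hlt with h | h
      · rw [sub_eq_zero] at h
        rcases hz with hz | hz
        · exact hsx0 (h.trans hz)
        · rw [← h, hvsx] at hz
          exact lt_irrefl _ hz
      · rcases hz with hz | hz
        · rw [hz, sub_zero, hvsx] at h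
          exact lt_irrefl _ h
        · by_cases h0 : (s : R) * x - z = 0
          · rw [← sub_eq_zero.mp h0, hvsx] at hz
            exact lt_irrefl _ hz
          by_cases hz0 : z = 0
          · rw [hz0, sub_zero, hvsx] at h
            exact lt_irrefl _ h
          have := vadd _ z h0 hz0 (by simpa using hsx0)
          rw [sub_add_cancel, hvsx] at this
          exact absurd this (not_le.mpr (lt_min h hz))
    have hQx (x : R) (hxφ : v₂ x = φ₂) : x ∈ Q := (hQ x).mpr (Or.inr hxφ.ge)
    have hmem (x : R) (hxφ : v₂ x = φ₂) : LocalizedModule.mkLinearMap p.primeCompl M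
        (Submodule.Quotient.mk ⟨x, hQx x hxφ⟩) ∈ (N (v x)).localized p.primeCompl := by
      rw [mkLinearMap_mem_localized_iff]
      refine ⟨1, ?_⟩
      rw [one_smul]
      exact ⟨⟨x, hQx x hxφ⟩, Or.inr le_rfl, rfl⟩
    refine card_le_krullDim_of_strictAntiOn (fun γ ↦ (N γ).localized p.primeCompl) T ?_ ?_
    · intro γ hγ δ _ hlt
      obtain ⟨⟨x, hx, rfl⟩, hxφ⟩ := hT hγ
      refine lt_of_le_not_ge ?_ fun hle ↦ ?_
      · rintro _ ⟨m, hm, s, rfl⟩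
        refine ⟨m, ?_, s, rfl⟩
        obtain ⟨z, hz, rfl⟩ := hm
        exact ⟨z, Or.imp_right hlt.le.trans hz, rfl⟩
      · obtain ⟨s, hs⟩ := (mkLinearMap_mem_localized_iff ..).mp (hle (hmem x hxφ))
        obtain ⟨z, hz, hzs⟩ := Submodule.mem_map.mp hs
        have := (Submodule.Quotient.eq _).mp hzs.symm
        exact key x hx hxφ s z (Or.imp_right hlt.trans_le hz) this
    · intro γ hγ hbot
      obtain ⟨⟨x, hx, rfl⟩, hxφ⟩ := hT hγ
      have h0 := hmem x hxφ
      have hbot' : (N (v x)).localized p.primeCompl = ⊥ := hbot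
      rw [hbot', Submodule.mem_bot, IsLocalizedModule.eq_zero_iff p.primeCompl] at h0
      obtain ⟨s, hs⟩ := h0
      have := (Submodule.Quotient.mk_eq_zero _).mp hs
      exact key x hx hxφ s 0 (Or.inl rfl) (by simpa using this)
  have hFfin : F.Finite := by
    by_contra hinf
    obtain ⟨m, hm⟩ := WithBot.ne_bot_iff_exists.mp
      (Order.krullDim_ne_bot_iff (α := Submodule (Localization p.primeCompl)
        (LocalizedModule p.primeCompl M)) |>.mpr inferInstance)
    obtain ⟨k, rfl⟩ := ENat.ne_top_iff_exists.mp
      (WithBot.coe_lt_coe.mp (lt_of_eq_of_lt hm hfin)).ne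
    obtain ⟨T, hT, hTk⟩ := Set.Infinite.exists_subset_card_eq hinf (k + 1)
    have := (hcard T hT).trans_eq hm.symm
    rw [hTk] at this
    have h' : k + 1 ≤ k := by exact_mod_cast this
    omega
  refine ⟨hFfin, ?_, hfin⟩
  rw [Set.ncard_eq_toFinset_card F hFfin]
  exact hcard _ (by simp)
end

section
/- Fix an integer s ≥ 3 and set r = s − 2. Let S = {(2^m + j) + α/2^{(m+1)r} : m, j, α ∈ ℕ, 0 ≤ j < 2^m, 0 ≤ α < 2^{(m+1)r}} ⊆ ℚ, let c(0) = 1 and c(i) = i for i ≥ 1, and let T = ⋃_{m ∈ ℕ} {m} × (1/c(m))·S ⊆ ℚ × ℚ, where ℚ × ℚ carries the lexicographic order. Then there is no noetherian local domain R of Krull dimension s, with maximal ideal m_R, together with a valuation ν of the fraction field of R taking values in the lexicographically ordered group ℚ × ℚ and dominating R, such that ν(m_R∖{0}) = T. -/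
/-- The semigroup `S` of Example 3, for a given `r`. -/
def exS (r : ℕ) : Set ℚ :=
  {q : ℚ | ∃ m j α : ℕ, j < 2 ^ m ∧ α < 2 ^ ((m + 1) * r) ∧
    q = (2 ^ m + j : ℚ) + (α : ℚ) / 2 ^ ((m + 1) * r)}

/-- The function `c` of Example 3: `c 0 = 1` and `c i = i` for `i ≥ 1`. -/
def exc (i : ℕ) : ℚ := if i = 0 then 1 else (i : ℚ)

/-- The rank-2 semigroup `T = ⋃_m {m} × (1/c(m))·S ⊆ ℚ ×ₗ ℚ` of Example 3. -/
def exT (r : ℕ) : Set (ℚ ×ₗ ℚ) :=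
  {γ : ℚ ×ₗ ℚ | ∃ m : ℕ, ∃ q ∈ exS r, γ = toLex ((m : ℚ), q / exc m)}

open IsLocalRing

theorem Module.length_quotient_ne_top_of_mem_minimalPrimes {R : Type*} [CommRing R]
    [IsNoetherianRing R] [IsLocalRing R] {I : Ideal R} (h : maximalIdeal R ∈ I.minimalPrimes) :
    Module.length R (R ⧸ I) ≠ ⊤ := by
  have := IsLocalRing.quotient_artinian_of_mem_minimalPrimes_of_isLocalRing I h
  rw [Module.length_eq_of_surjective (R := R ⧸ I) Ideal.Quotient.mk_surjective]
  exact Module.length_ne_top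

theorem Module.length_quotient_le_of_le {R M : Type*} [Ring R] [AddCommGroup M] [Module R M]
    {p q : Submodule R M} (h : p ≤ q) : Module.length R (M ⧸ q) ≤ Module.length R (M ⧸ p) :=
  Module.length_le_of_surjective (Submodule.factor h) (Submodule.factor_surjective h)

theorem Module.length_quotient_add_one_le_of_lt {R M : Type*} [Ring R] [AddCommGroup M]
    [Module R M] {p q : Submodule R M} (h : p < q) :
    Module.length R (M ⧸ q) + 1 ≤ Module.length R (M ⧸ p) := by
  rw [Module.length_quotient, Module.length_quotient]
  exact Order.coheight_add_one_le h

theorem Ideal.length_quotient_sup_span_pow_le {R : Type*} [CommRing R] (J : Ideal R) (x : R)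
    (n : ℕ) : Module.length R (R ⧸ (J ⊔ Ideal.span {x ^ n})) ≤
      n * Module.length R (R ⧸ (J ⊔ Ideal.span {x})) := by
  induction n with
  | zero =>
    have : J ⊔ Ideal.span {x ^ 0} = ⊤ := by simp
    rw [this, Module.length_eq_zero_iff.mpr]
    · simp
    · exact Ideal.Quotient.subsingleton_iff.mpr rfl
  | succ n ih =>
    let f : R →ₗ[R] R ⧸ (J ⊔ Ideal.span {x ^ (n + 1)}) :=
      (J ⊔ Ideal.span {x ^ (n + 1)}).mkQ.comp (LinearMap.mulLeft R (x ^ n))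
    have hf : J ⊔ Ideal.span {x} ≤ LinearMap.ker f := by
      refine sup_le (fun y hy => ?_) ?_
      · simp only [f, LinearMap.mem_ker, LinearMap.comp_apply, LinearMap.mulLeft_apply,
          Submodule.mkQ_apply, Submodule.Quotient.mk_eq_zero]
        exact Ideal.mem_sup_left (J.mul_mem_left _ hy)
      · rw [Ideal.span_singleton_le_iff_mem]
        simp only [f, LinearMap.mem_ker, LinearMap.comp_apply, LinearMap.mulLeft_apply,
          Submodule.mkQ_apply, Submodule.Quotient.mk_eq_zero, ← pow_succ]
        exact Ideal.mem_sup_right (Ideal.mem_span_singleton_self _)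
    have hle : J ⊔ Ideal.span {x ^ (n + 1)} ≤ J ⊔ Ideal.span {x ^ n} :=
      sup_le_sup_left (Ideal.span_singleton_le_span_singleton.mpr (pow_dvd_pow x n.le_succ)) _
    let g := Submodule.factor hle
    have hker : LinearMap.range ((J ⊔ Ideal.span {x}).liftQ f hf) = LinearMap.ker g := by
      rw [Submodule.range_liftQ]
      apply le_antisymm
      · rintro _ ⟨y, rfl⟩
        exact (Submodule.Quotient.mk_eq_zero (J ⊔ Ideal.span {x ^ n})).mpr
          (Ideal.mem_sup_right (Ideal.mul_mem_right _ _ (Ideal.mem_span_singleton_self _)))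
      · intro y hy
        obtain ⟨y, rfl⟩ := Submodule.mkQ_surjective _ y
        obtain ⟨j, hj, z, hz, rfl⟩ := Submodule.mem_sup.mp
          ((Submodule.Quotient.mk_eq_zero (J ⊔ Ideal.span {x ^ n})).mp hy)
        obtain ⟨c, rfl⟩ := Ideal.mem_span_singleton.mp hz
        refine ⟨c, ?_⟩
        simp only [f, LinearMap.comp_apply, LinearMap.mulLeft_apply, Submodule.mkQ_apply]
        rw [Submodule.Quotient.eq]
        exact Ideal.mem_sup_left (by simpa using J.neg_mem hj)
    rw [Module.length_eq_add_of_exact (LinearMap.ker g).subtype g (Submodule.subtype_injective _)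
      (Submodule.factor_surjective hle) (LinearMap.exact_subtype_ker_map g), ← hker]
    calc _ ≤ Module.length R (R ⧸ (J ⊔ Ideal.span {x})) +
          n * Module.length R (R ⧸ (J ⊔ Ideal.span {x})) :=
          add_le_add (Module.length_le_of_surjective _ (LinearMap.surjective_rangeRestrict _)) ih
      _ = _ := by push_cast; ring

theorem Ideal.length_quotient_sup_span_image_pow_le {R : Type*} [CommRing R] (s : Finset R)
    (J : Ideal R) (n : ℕ) :
    Module.length R (R ⧸ (J ⊔ Ideal.span ((· ^ n) '' (s : Set R)))) ≤
      (n ^ s.card : ℕ) * Module.length R (R ⧸ (J ⊔ Ideal.span (s : Set R))) := by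
  classical
  induction s using Finset.induction_on generalizing J with
  | empty =>
    rw [Finset.coe_empty, Set.image_empty, Finset.card_empty, pow_zero, Nat.cast_one, one_mul]
  | insert x s hx ih =>
    rw [Finset.coe_insert, Set.image_insert_eq, Ideal.span_insert, Ideal.span_insert,
      ← sup_assoc, ← sup_assoc, Finset.card_insert_of_notMem hx]
    refine (ih _).trans ?_
    rw [sup_right_comm, sup_right_comm J (Ideal.span {x}), pow_succ, Nat.cast_mul, mul_assoc]
    gcongr
    exact Ideal.length_quotient_sup_span_pow_le _ _ _

theorem IsLocalRing.exists_length_quotient_pow_le {R : Type*} [CommRing R]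
    [IsNoetherianRing R] [IsLocalRing R] (d : ℕ) (hd : ringKrullDim R = d) :
    ∃ C : ℕ, ∀ n : ℕ, Module.length R (R ⧸ maximalIdeal R ^ n) ≤ (C * n ^ d : ℕ) := by
  obtain ⟨s, hs, hcard⟩ :=
    (maximalIdeal R).exists_finset_card_eq_height_of_isNoetherianRing
  have hsd : s.card = d := by
    rw [← maximalIdeal_height_eq_ringKrullDim, ← hcard] at hd
    exact_mod_cast hd
  obtain ⟨C, hC⟩ := ENat.ne_top_iff_exists.mp
    (Module.length_quotient_ne_top_of_mem_minimalPrimes hs)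
  refine ⟨C, fun n => ?_⟩
  have h := Ideal.length_quotient_sup_span_image_pow_le s ⊥ n
  rw [bot_sup_eq, bot_sup_eq, ← hC, hsd] at h
  refine (Module.length_quotient_le_of_le ?_).trans (h.trans (by push_cast; rw [mul_comm]))
  rw [Ideal.span_le]
  rintro _ ⟨x, hx, rfl⟩
  exact Ideal.pow_mem_pow (hs.1.2 (Ideal.subset_span hx)) n

theorem Ideal.IsPrime.exists_length_quotient_sup_pow_le {R : Type*} [CommRing R]
    [IsNoetherianRing R] [IsLocalRing R] (P : Ideal R) [P.IsPrime] (d : ℕ)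
    (hd : ringKrullDim (R ⧸ P) = d) :
    ∃ C : ℕ, ∀ n : ℕ, Module.length R (R ⧸ (P ⊔ maximalIdeal R ^ n)) ≤ (C * n ^ d : ℕ) := by
  have : IsLocalRing (R ⧸ P) := .of_surjective' (Ideal.Quotient.mk P) Ideal.Quotient.mk_surjective
  obtain ⟨C, hC⟩ := IsLocalRing.exists_length_quotient_pow_le d hd
  refine ⟨C, fun n => le_trans ?_ (hC n)⟩
  rw [← Module.length_eq_of_surjective (R := R ⧸ P) (S := R) Ideal.Quotient.mk_surjective]
  let f : R →ₗ[R] (R ⧸ P) ⧸ maximalIdeal (R ⧸ P) ^ n :=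
    ((maximalIdeal (R ⧸ P) ^ n).restrictScalars R).mkQ.comp P.mkQ
  have hs : Function.Surjective f :=
    (Submodule.mkQ_surjective _).comp (Submodule.mkQ_surjective _)
  have hk : LinearMap.ker f ≤ P ⊔ maximalIdeal R ^ n := by
    intro x hx
    have hx' : Ideal.Quotient.mk P x ∈ maximalIdeal (R ⧸ P) ^ n := by
      have : Ideal.Quotient.mk _ (Ideal.Quotient.mk P x) =
          (0 : (R ⧸ P) ⧸ maximalIdeal (R ⧸ P) ^ n) := hx
      exact Ideal.Quotient.eq_zero_iff_mem.mp this
    have hm : maximalIdeal (R ⧸ P) = (maximalIdeal R).map (Ideal.Quotient.mk P) := by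
      have := IsLocalHom.of_surjective (Ideal.Quotient.mk P) Ideal.Quotient.mk_surjective
      ext x
      obtain ⟨x, rfl⟩ := Ideal.Quotient.mk_surjective x
      simp [sup_eq_left.mpr (le_maximalIdeal (Ideal.IsPrime.ne_top ‹_›))]
    rw [hm, ← Ideal.map_pow, Ideal.mem_map_iff_of_surjective _ Ideal.Quotient.mk_surjective] at hx'
    obtain ⟨y, hy, hxy⟩ := hx'
    have := Ideal.Quotient.eq.mp hxy
    have h2 : x = -(y - x) + y := by ring
    rw [h2]
    exact Submodule.add_mem_sup (P.neg_mem this) hy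
  rw [← (f.quotKerEquivOfSurjective hs).length_eq]
  exact Module.length_quotient_le_of_le hk

theorem Module.exists_span_range_eq_top_of_length_le {R : Type*} [Ring R] (n : ℕ) :
    ∀ (M : Type*) [AddCommGroup M] [Module R M], Module.length R M ≤ n →
      ∃ f : Fin n → M, Submodule.span R (Set.range f) = ⊤ := by
  induction n with
  | zero =>
    intro M _ _ h
    have : Subsingleton M := Module.length_eq_zero_iff.mp (by simpa using h)
    exact ⟨0, Subsingleton.elim _ _⟩
  | succ n ih =>
    intro M _ _ h
    rcases subsingleton_or_nontrivial M with hM | hM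
    · exact ⟨0, Subsingleton.elim _ _⟩
    obtain ⟨x, hx⟩ := exists_ne (0 : M)
    have hlt : Module.length R (M ⧸ Submodule.span R {x}) ≤ n := by
      have h1 : (⊥ : Submodule R M) < Submodule.span R {x} := by
        rw [bot_lt_iff_ne_bot, Ne, Submodule.span_singleton_eq_bot]; exact hx
      have h2 := Module.length_quotient_add_one_le_of_lt h1
      rw [(Submodule.quotEquivOfEqBot _ rfl).length_eq] at h2
      have h3 := h2.trans h
      rw [Nat.cast_succ] at h3
      exact (ENat.add_le_add_iff_right ENat.one_ne_top).mp h3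
    obtain ⟨f, hf⟩ := ih _ hlt
    choose g hg using fun i => Submodule.mkQ_surjective _ (f i)
    refine ⟨Fin.cons x g, ?_⟩
    rw [Fin.range_cons, Submodule.span_insert]
    rw [← Submodule.map_mkQ_eq_top, Submodule.map_span, ← Set.range_comp, ← hf]
    exact congrArg _ (congrArg _ (funext hg))

theorem Ideal.length_quotient_smul_le {R : Type*} [CommRing R] [IsDomain R] (J : Ideal R) {x : R}
    (hx : x ≠ 0) (hJ : Module.length R (R ⧸ J) ≠ ⊤) :
    Module.length R (J ⧸ (Ideal.span {x} • (⊤ : Submodule R J))) ≤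
      Module.length R (R ⧸ Ideal.span {x}) := by
  have hle : Ideal.span {x} * J ≤ J := Ideal.mul_le_right
  have hle' : Ideal.span {x} * J ≤ Ideal.span {x} := Ideal.mul_le_left
  let g := Submodule.factor hle
  let g' := Submodule.factor hle'
  let f : J →ₗ[R] R ⧸ (Ideal.span {x} * J) := (Ideal.span {x} * J).mkQ.comp J.subtype
  let f' : R →ₗ[R] R ⧸ (Ideal.span {x} * J) :=
    (Ideal.span {x} * J).mkQ.comp (LinearMap.mulLeft R x)
  have hf : LinearMap.ker f = Ideal.span {x} • (⊤ : Submodule R J) := by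
    ext y
    rw [LinearMap.mem_ker]
    refine (Submodule.Quotient.mk_eq_zero (Ideal.span {x} * J)).trans ?_
    rw [Submodule.mem_smul_top_iff, smul_eq_mul]
    rfl
  have hf' : LinearMap.ker f' = J := by
    ext y
    rw [LinearMap.mem_ker]
    refine (Submodule.Quotient.mk_eq_zero (Ideal.span {x} * J)).trans ?_
    rw [LinearMap.mulLeft_apply, Ideal.mem_span_singleton_mul]
    exact ⟨fun ⟨z, hz, h⟩ => mul_left_cancel₀ hx h ▸ hz, fun h => ⟨y, h, rfl⟩⟩
  have hr : LinearMap.range f = LinearMap.ker g := by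
    ext y
    obtain ⟨y, rfl⟩ := Submodule.mkQ_surjective _ y
    rw [LinearMap.mem_ker]
    refine Iff.trans ?_ (Submodule.Quotient.mk_eq_zero J).symm
    constructor
    · rintro ⟨z, hz⟩
      have := hle ((Submodule.Quotient.eq _).mp hz)
      exact (Submodule.sub_mem_iff_right _ z.2).mp this
    · exact fun h => ⟨⟨y, h⟩, rfl⟩
  have hr' : LinearMap.range f' = LinearMap.ker g' := by
    ext y
    obtain ⟨y, rfl⟩ := Submodule.mkQ_surjective _ y
    rw [LinearMap.mem_ker]
    refine Iff.trans ?_ (Submodule.Quotient.mk_eq_zero (Ideal.span {x})).symm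
    constructor
    · rintro ⟨z, hz⟩
      have := hle' ((Submodule.Quotient.eq _).mp hz)
      exact (Submodule.sub_mem_iff_right _
        (Ideal.mul_mem_right _ _ (Ideal.mem_span_singleton_self x))).mp this
    · intro h
      obtain ⟨c, rfl⟩ := Ideal.mem_span_singleton.mp h
      exact ⟨c, rfl⟩
  have e := Module.length_eq_add_of_exact (LinearMap.ker g).subtype g
    (Submodule.subtype_injective _) (Submodule.factor_surjective hle)
    (LinearMap.exact_subtype_ker_map g)
  have e' := Module.length_eq_add_of_exact (LinearMap.ker g').subtype g'
    (Submodule.subtype_injective _) (Submodule.factor_surjective hle')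
    (LinearMap.exact_subtype_ker_map g')
  rw [← hr, ← f.quotKerEquivRange.length_eq, hf] at e
  rw [← hr', ← f'.quotKerEquivRange.length_eq, hf', e, add_comm] at e'
  exact (ENat.add_le_add_iff_left hJ).mp e'.le

theorem IsLocalRing.exists_forall_ideal_eq_span_range {R : Type*} [CommRing R] [IsDomain R]
    [IsNoetherianRing R] [IsLocalRing R] (hm : maximalIdeal R ≠ ⊥)
    (h : ∀ Q : Ideal R, Q.IsPrime → Q ≠ ⊥ → Q = maximalIdeal R) :
    ∃ L : ℕ, ∀ J : Ideal R, ∃ f : Fin L → R, J = Ideal.span (Set.range f) := by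
  have hfin (J : Ideal R) (hJ : J ≠ ⊥) : Module.length R (R ⧸ J) ≠ ⊤ := by
    by_cases hJt : J = ⊤
    · have : Subsingleton (R ⧸ J) := Ideal.Quotient.subsingleton_iff.mpr hJt
      simp
    refine Module.length_quotient_ne_top_of_mem_minimalPrimes
      ⟨⟨inferInstance, le_maximalIdeal hJt⟩, fun Q hQ _ => ?_⟩
    exact (h Q hQ.1 fun hQb => hJ (le_bot_iff.mp (hQb ▸ hQ.2))).ge
  obtain ⟨x, hxm, hx⟩ := Submodule.exists_mem_ne_zero_of_ne_bot hm
  obtain ⟨L, hL⟩ := ENat.ne_top_iff_exists.mp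
    (hfin (Ideal.span {x}) (by simpa [Ideal.span_singleton_eq_bot] using hx))
  refine ⟨L, fun J => ?_⟩
  by_cases hJ : J = ⊥
  · refine ⟨0, hJ.trans (Eq.symm ?_)⟩
    rw [Ideal.span_eq_bot]
    rintro _ ⟨i, rfl⟩
    rfl
  obtain ⟨f, hf⟩ := Module.exists_span_range_eq_top_of_length_le L _
    ((Ideal.length_quotient_smul_le J hx (hfin J hJ)).trans hL.ge)
  choose g hg using fun i => Submodule.mkQ_surjective _ (f i)
  have htop : Submodule.span R (Set.range g) = ⊤ := by
    have h1 : (Ideal.span {x} • (⊤ : Submodule R J)) ⊔ Submodule.span R (Set.range g) = ⊤ := by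
      rw [← Submodule.map_mkQ_eq_top, Submodule.map_span, ← Set.range_comp, ← hf]
      exact congrArg _ (congrArg _ (funext hg))
    rw [eq_top_iff]
    refine Submodule.le_of_le_smul_of_le_jacobson_bot (I := Ideal.span {x})
      (IsNoetherian.noetherian _) ?_ (by rw [sup_comm, h1])
    rw [IsLocalRing.jacobson_eq_maximalIdeal _ bot_ne_top]
    simpa [Ideal.span_singleton_le_iff_mem] using hxm
  refine ⟨fun i => g i, ?_⟩
  have := congrArg (Submodule.map J.subtype) htop
  rw [Submodule.map_span, ← Set.range_comp, Submodule.map_top, Submodule.range_subtype] at this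
  exact this.symm

theorem Ideal.exists_forall_mul_mem_span_range {R : Type*} [CommRing R] [IsDomain R]
    [IsNoetherianRing R] (P : Ideal R) [P.IsPrime] (hP : P ≠ ⊥)
    (h : ∀ Q : Ideal R, Q.IsPrime → Q < P → Q = ⊥) :
    ∃ L : ℕ, ∀ J : Ideal R, ∃ f : Fin L → R, (∀ i, f i ∈ J) ∧
      ∃ a ∉ P, ∀ x ∈ J, a * x ∈ Ideal.span (Set.range f) := by
  let B := Localization.AtPrime P
  have hinj : Function.Injective (algebraMap R B) :=
    IsLocalization.injective B P.primeCompl_le_nonZeroDivisors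
  have : IsDomain B := IsLocalization.isDomain_localization P.primeCompl_le_nonZeroDivisors
  have : IsNoetherianRing B := IsLocalization.isNoetherianRing P.primeCompl B inferInstance
  have hmap : P.map (algebraMap R B) = maximalIdeal B := Localization.AtPrime.map_eq_maximalIdeal
  obtain ⟨L, hL⟩ := IsLocalRing.exists_forall_ideal_eq_span_range (R := B)
    (by rwa [← hmap, Ne, Ideal.map_eq_bot_iff_of_injective hinj]) (by
      intro Q hQ hQb
      have hc : Q.under R ≤ P :=
        (Ideal.comap_mono (le_maximalIdeal hQ.ne_top)).trans_eq
          (IsLocalization.AtPrime.under_maximalIdeal B P)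
      have hQ' := IsLocalization.map_under P.primeCompl B Q
      rcases hc.lt_or_eq with hlt | heq
      · rw [h _ inferInstance hlt, Ideal.map_bot] at hQ'
        exact absurd hQ'.symm hQb
      · rw [← hQ', heq, hmap])
  refine ⟨L, fun J => ?_⟩
  obtain ⟨f, hf⟩ := hL (J.map (algebraMap R B))
  have hfm (i) : ∃ p : R, p ∈ J ∧
      ∃ t : P.primeCompl, f i * algebraMap R B t = algebraMap R B p := by
    have : f i ∈ J.map (algebraMap R B) := hf ▸ Ideal.subset_span ⟨i, rfl⟩
    obtain ⟨⟨p, t⟩, hpt⟩ := (IsLocalization.mem_map_algebraMap_iff P.primeCompl B).mp this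
    exact ⟨p, p.2, t, hpt⟩
  choose p hp t ht using hfm
  refine ⟨p, hp, ?_⟩
  have hspan : J.map (algebraMap R B) ≤ (Ideal.span (Set.range p)).map (algebraMap R B) := by
    rw [hf, Ideal.span_le]
    rintro _ ⟨i, rfl⟩
    have hu := IsLocalization.map_units B (t i)
    rw [SetLike.mem_coe, ← Ideal.mul_unit_mem_iff_mem _ hu, ht]
    exact Ideal.mem_map_of_mem _ (Ideal.subset_span ⟨i, rfl⟩)
  have hone (x : R) (hx : x ∈ J) : ∃ a ∉ P, a * x ∈ Ideal.span (Set.range p) := by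
    obtain ⟨⟨y, a⟩, hya⟩ := (IsLocalization.mem_map_algebraMap_iff P.primeCompl B).mp
      (hspan (Ideal.mem_map_of_mem _ hx))
    rw [← map_mul] at hya
    refine ⟨a, a.2, ?_⟩
    rw [mul_comm, hinj hya]
    exact y.2
  obtain ⟨G, hG⟩ : J.FG := IsNoetherian.noetherian J
  have hfin (G : Finset R) (hGJ : (G : Set R) ⊆ J) :
      ∃ a ∉ P, ∀ x ∈ G, a * x ∈ Ideal.span (Set.range p) := by
    classical
    induction G using Finset.induction_on with
    | empty => exact ⟨1, P.one_notMem, by simp⟩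
    | insert x s _ ih =>
      rw [Finset.coe_insert, Set.insert_subset_iff] at hGJ
      obtain ⟨a, ha, ha'⟩ := ih hGJ.2
      obtain ⟨b, hb, hb'⟩ := hone x hGJ.1
      refine ⟨a * b, Ideal.IsPrime.mul_notMem inferInstance ha hb, fun y hy => ?_⟩
      rcases Finset.mem_insert.mp hy with rfl | hy
      · rw [mul_assoc]
        exact Ideal.mul_mem_left _ _ hb'
      · rw [mul_right_comm]
        exact Ideal.mul_mem_right _ _ (ha' y hy)
  obtain ⟨a, ha, ha'⟩ := hfin G (hG ▸ Submodule.subset_span)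
  refine ⟨a, ha, fun x hx => ?_⟩
  have hle : J ≤ Submodule.comap (LinearMap.mulLeft R a) (Ideal.span (Set.range p)) := by
    rw [← hG]
    exact Submodule.span_le.mpr ha'
  exact hle hx

theorem ringKrullDim_add_one_le_of_surjective {A B : Type*} [CommRing A] [IsDomain A] [CommRing B]
    (f : A →+* B) (hf : Function.Surjective f) (hi : ¬ Function.Injective f) :
    ringKrullDim B + 1 ≤ ringKrullDim A := by
  rw [injective_iff_map_eq_zero] at hi
  push Not at hi
  obtain ⟨x, hx, hx0⟩ := hi
  refine le_trans ?_ (ringKrullDim_quotient_succ_le_of_nonZeroDivisor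
    (mem_nonZeroDivisors_of_ne_zero hx0))
  gcongr
  exact ringKrullDim_le_of_surjective
    (Ideal.Quotient.lift (Ideal.span {x}) f
      ((Ideal.span_singleton_le_iff_mem (I := RingHom.ker f)).mpr hx))
    (Ideal.Quotient.lift_surjective_of_surjective _ _ hf)

theorem Ideal.ringKrullDim_quotient_add_one_le_of_lt {R : Type*} [CommRing R] {P Q : Ideal R}
    [Q.IsPrime] (h : Q < P) : ringKrullDim (R ⧸ P) + 1 ≤ ringKrullDim (R ⧸ Q) := by
  refine ringKrullDim_add_one_le_of_surjective (Ideal.Quotient.factor h.le)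
    (Ideal.Quotient.factor_surjective h.le) fun hi => ?_
  obtain ⟨x, hxP, hxQ⟩ := Set.exists_of_ssubset h
  refine hxQ (Ideal.Quotient.eq_zero_iff_mem.mp (hi ?_))
  rw [map_zero, Ideal.Quotient.factor_mk]
  exact Ideal.Quotient.eq_zero_iff_mem.mpr hxP

/-- The function `v` satisfies the axioms of an additive valuation, with nonnegative values, on the
nonzero elements of `R`. -/
structure IsNonnegValuation {R Γ : Type*} [CommRing R] [AddCommMonoid Γ] [LinearOrder Γ]
    (v : R → Γ) : Prop where
  map_mul : ∀ x y : R, x ≠ 0 → y ≠ 0 → v (x * y) = v x + v y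
  min_le_map_add : ∀ x y : R, x ≠ 0 → y ≠ 0 → x + y ≠ 0 → min (v x) (v y) ≤ v (x + y)
  nonneg : ∀ x : R, x ≠ 0 → 0 ≤ v x

namespace IsNonnegValuation

section General

variable {R Γ : Type*} [CommRing R] [AddCommMonoid Γ] [LinearOrder Γ] [IsOrderedAddMonoid Γ]
  {v : R → Γ}

/-- The ideal of elements of value at least `γ`. -/
def ideal (h : IsNonnegValuation v) (γ : Γ) : Ideal R where
  carrier := {x | x ≠ 0 → γ ≤ v x}
  zero_mem' h0 := absurd rfl h0
  add_mem' {x y} hx hy hxy := by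
    by_cases hx0 : x = 0
    · subst hx0
      rw [zero_add] at hxy ⊢
      exact hy hxy
    by_cases hy0 : y = 0
    · subst hy0
      rw [add_zero] at hxy ⊢
      exact hx hxy
    exact (le_min (hx hx0) (hy hy0)).trans (h.min_le_map_add x y hx0 hy0 hxy)
  smul_mem' c x hx hcx := by
    have hc := left_ne_zero_of_mul hcx
    have hx0 := right_ne_zero_of_mul hcx
    rw [smul_eq_mul, h.map_mul c x hc hx0]
    exact (hx hx0).trans (le_add_of_nonneg_left (h.nonneg c hc))

theorem mem_ideal_iff (h : IsNonnegValuation v) {γ : Γ} {x : R} (hx : x ≠ 0) :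
    x ∈ h.ideal γ ↔ γ ≤ v x := ⟨fun H => H hx, fun H _ => H⟩

theorem ideal_antitone (h : IsNonnegValuation v) : Antitone h.ideal :=
  fun _ _ hγ _ hx h0 => hγ.trans (hx h0)

theorem mul_mem_ideal (h : IsNonnegValuation v) {γ δ : Γ} {x y : R} (hx : x ∈ h.ideal γ)
    (hy : y ∈ h.ideal δ) : x * y ∈ h.ideal (γ + δ) := by
  intro hxy
  have hx0 := left_ne_zero_of_mul hxy
  have hy0 := right_ne_zero_of_mul hxy
  rw [h.map_mul x y hx0 hy0]
  exact add_le_add (hx hx0) (hy hy0)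

theorem pow_le_ideal (h : IsNonnegValuation v) {γ : Γ} {I : Ideal R} (hI : I ≤ h.ideal γ) (n : ℕ) :
    I ^ n ≤ h.ideal (n • γ) := by
  induction n with
  | zero => exact fun x _ hx => (zero_nsmul γ).trans_le (h.nonneg x hx)
  | succ n ih =>
    rw [pow_succ, Ideal.mul_le]
    intro x hx y hy
    rw [succ_nsmul]
    exact h.mul_mem_ideal (ih hx) (hI hy)

theorem card_le_length (h : IsNonnegValuation v) {M : Type*} [AddCommGroup M] [Module R M]
    (φ : M →ₗ[R] R) (T : Finset Γ) (hT : ∀ γ ∈ T, ∃ y, φ y ≠ 0 ∧ v (φ y) = γ) :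
    ∀ γ₀, (∀ γ ∈ T, γ < γ₀) →
      (T.card : ℕ∞) ≤ Module.length R (M ⧸ Submodule.comap φ (h.ideal γ₀)) := by
  classical
  induction T using Finset.induction_on_max with
  | empty => simp
  | insert a T ha ih =>
    intro γ₀ hγ₀
    obtain ⟨y, hy0, hya⟩ := hT a (Finset.mem_insert_self _ _)
    have haγ := hγ₀ a (Finset.mem_insert_self _ _)
    rw [Finset.card_insert_of_notMem fun H => (ha a H).false, Nat.cast_succ]
    refine le_trans ?_ (Module.length_quotient_add_one_le_of_lt
      (q := Submodule.comap φ (h.ideal a)) ?_)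
    · gcongr
      exact ih (fun γ hγ => hT γ (Finset.mem_insert_of_mem hγ)) a ha
    · refine lt_of_le_of_ne (Submodule.comap_mono (h.ideal_antitone haγ.le)) fun e => ?_
      have hy : y ∈ Submodule.comap φ (h.ideal a) := fun _ => hya.ge
      rw [← e] at hy
      exact (haγ.trans_le ((hy hy0).trans hya.le)).false

theorem card_le_mul_length (h : IsNonnegValuation v) {L : ℕ} (f : Fin L → R) (I : Ideal R)
    (T : Finset Γ) (hT : ∀ γ ∈ T, ∃ y ∈ Ideal.span (Set.range f), y ≠ 0 ∧ v y = γ) (γ₀ : Γ)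
    (hγ₀ : ∀ γ ∈ T, γ < γ₀) (hI : ∀ i, ∀ x ∈ I, x * f i ∈ h.ideal γ₀) :
    (T.card : ℕ∞) ≤ L * Module.length R (R ⧸ I) := by
  let φ : (Fin L → R) →ₗ[R] R := Fintype.linearCombination R f
  refine (h.card_le_length φ T (fun γ hγ => ?_) γ₀ hγ₀).trans ?_
  · obtain ⟨y, hy, hy0, hyγ⟩ := hT γ hγ
    have : y ∈ LinearMap.range φ := by
      rw [Fintype.range_linearCombination]
      exact hy
    obtain ⟨z, rfl⟩ := this
    exact ⟨z, hy0, hyγ⟩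
  · have hle : Submodule.pi Set.univ (fun _ : Fin L => I) ≤ Submodule.comap φ (h.ideal γ₀) := by
      intro x hx
      rw [Submodule.mem_comap, Fintype.linearCombination_apply]
      exact Submodule.sum_mem _ fun i _ => hI i _ (hx i (Set.mem_univ i))
    refine (Module.length_quotient_le_of_le hle).trans ?_
    rw [(Submodule.quotientPi fun _ : Fin L => I).length_eq, Module.length_pi]
    simp

end General

section Lex

variable {R : Type*} [CommRing R] [IsDomain R] {v : R → ℚ ×ₗ ℚ}

theorem nsmul_toLex_zero_one (n : ℕ) :
    n • (toLex (0, 1) : ℚ ×ₗ ℚ) = toLex ((0 : ℚ), (n : ℚ)) := by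
  induction n with
  | zero => rw [zero_nsmul, Nat.cast_zero]; rfl
  | succ n ih => rw [succ_nsmul, ih, ← toLex_add, Prod.mk_add_mk, zero_add, Nat.cast_succ]

theorem map_eq_zero_of_isUnit (h : IsNonnegValuation v) {x : R} (hx : IsUnit x) : v x = 0 := by
  obtain ⟨y, hxy⟩ := hx.exists_right_inv
  have hy : y ≠ 0 := right_ne_zero_of_mul (hxy ▸ one_ne_zero)
  have h1 : v 1 = 0 := by
    have := h.map_mul 1 1 one_ne_zero one_ne_zero
    rwa [mul_one, left_eq_add] at this
  have h2 := h.map_mul x y hx.ne_zero hy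
  rw [hxy, h1] at h2
  exact le_antisymm (h2 ▸ le_add_of_nonneg_right (h.nonneg y hy)) (h.nonneg x hx.ne_zero)

theorem isPrime_ideal_one (h : IsNonnegValuation v)
    (hlev : ∀ x, x ≠ 0 → ∃ (k : ℕ) (b : ℚ), 0 ≤ b ∧ v x = toLex ((k : ℚ), b)) :
    (h.ideal (toLex (1, 0))).IsPrime := by
  have key (x : R) (hx : x ∉ h.ideal (toLex (1, 0))) : x ≠ 0 ∧ ∃ b, v x = toLex (0, b) := by
    have hx0 : x ≠ 0 := fun H => hx (H ▸ Ideal.zero_mem _)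
    obtain ⟨k, b, hb, hk⟩ := hlev x hx0
    refine ⟨hx0, b, ?_⟩
    rw [h.mem_ideal_iff hx0, hk, Prod.Lex.toLex_le_toLex] at hx
    push Not at hx
    rcases k.eq_zero_or_pos with rfl | hk0
    · simpa using hk
    · have : (1 : ℚ) ≤ k := by exact_mod_cast hk0
      rcases this.lt_or_eq with h1 | h1
      · exact absurd h1 (not_lt.mpr hx.1)
      · exact absurd (hx.2 h1) (not_lt.mpr hb)
  refine ⟨?_, fun {x y} hxy => ?_⟩
  · rw [Ne, Ideal.eq_top_iff_one, h.mem_ideal_iff one_ne_zero, h.map_eq_zero_of_isUnit isUnit_one,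
      ← toLex_zero, ← Prod.mk_zero_zero, Prod.Lex.toLex_le_toLex]
    norm_num
  · by_contra! H
    obtain ⟨hx, b, hb⟩ := key x H.1
    obtain ⟨hy, c, hc⟩ := key y H.2
    rw [h.mem_ideal_iff (mul_ne_zero hx hy), h.map_mul x y hx hy, hb, hc, ← toLex_add,
      Prod.mk_add_mk, Prod.Lex.toLex_le_toLex] at hxy
    norm_num at hxy

theorem exists_card_le_mul_length [IsLocalRing R] (h : IsNonnegValuation v)
    (hlev : ∀ x, x ≠ 0 → ∃ (k : ℕ) (b : ℚ), 0 ≤ b ∧ v x = toLex ((k : ℚ), b))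
    (hmax : maximalIdeal R ≤ h.ideal (toLex (0, 1))) (m : ℕ) {L : ℕ} (f : Fin L → R)
    (hf : ∀ i, f i ∈ h.ideal (toLex ((m : ℚ), 0))) {a : R} (ha : a ∉ h.ideal (toLex (1, 0)))
    (haf : ∀ x ∈ h.ideal (toLex ((m : ℚ), 0)), a * x ∈ Ideal.span (Set.range f)) :
    ∃ c : ℕ, ∀ (n : ℕ) (T : Finset ℚ),
      (∀ t ∈ T, t < n ∧ ∃ x, x ≠ 0 ∧ 0 ≤ t ∧ v x = toLex ((m : ℚ), t)) →
      (T.card : ℕ∞) ≤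
        L * Module.length R (R ⧸ (h.ideal (toLex (1, 0)) ⊔ maximalIdeal R ^ (n + c))) := by
  classical
  have ha0 : a ≠ 0 := fun H => ha (H ▸ Ideal.zero_mem _)
  obtain ⟨k, b, hb, hk⟩ := hlev a ha0
  have hk0 : k = 0 := by
    by_contra hk0
    apply ha
    rw [h.mem_ideal_iff ha0, hk, Prod.Lex.toLex_le_toLex]
    have : (1 : ℚ) ≤ k := by exact_mod_cast Nat.one_le_iff_ne_zero.mpr hk0
    exact this.lt_or_eq.imp id fun e => ⟨e, hb⟩
  subst hk0
  obtain ⟨c, hc⟩ := exists_nat_ge b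
  refine ⟨c, fun n T hT => ?_⟩
  have hinj : Function.Injective fun t : ℚ => toLex ((m : ℚ), b + t) := fun t u htu => by
    simpa using htu
  rw [← Finset.card_image_of_injective T hinj]
  refine h.card_le_mul_length f _ _ ?_ (toLex ((m : ℚ), ((n + c : ℕ) : ℚ))) ?_ ?_
  · intro γ hγ
    obtain ⟨t, ht, rfl⟩ := Finset.mem_image.mp hγ
    obtain ⟨-, x, hx, ht0, hxt⟩ := hT t ht
    refine ⟨a * x, haf x ?_, mul_ne_zero ha0 hx, ?_⟩
    · rw [h.mem_ideal_iff hx, hxt, Prod.Lex.toLex_le_toLex]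
      exact Or.inr ⟨rfl, ht0⟩
    · rw [h.map_mul a x ha0 hx, hk, hxt, ← toLex_add, Prod.mk_add_mk]
      simp
  · intro γ hγ
    obtain ⟨t, ht, rfl⟩ := Finset.mem_image.mp hγ
    rw [Prod.Lex.toLex_lt_toLex]
    refine Or.inr ⟨rfl, ?_⟩
    push_cast
    linarith [(hT t ht).1]
  · intro i x hx
    obtain ⟨y, hy, z, hz, rfl⟩ := Submodule.mem_sup.mp hx
    rw [add_mul]
    refine Ideal.add_mem _ (h.ideal_antitone ?_ (h.mul_mem_ideal hy (hf i)))
      (h.ideal_antitone ?_ (h.mul_mem_ideal (h.pow_le_ideal hmax _ hz) (hf i)))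
    · rw [← toLex_add, Prod.mk_add_mk, Prod.Lex.toLex_le_toLex]
      exact Or.inl (by simp)
    · rw [nsmul_toLex_zero_one, ← toLex_add, Prod.mk_add_mk, Prod.Lex.toLex_le_toLex]
      exact Or.inr (by simp)

end Lex

end IsNonnegValuation

theorem exc_pos (i : ℕ) : 0 < exc i := by
  unfold exc
  split_ifs with h
  · exact one_pos
  · exact_mod_cast Nat.pos_of_ne_zero h

theorem one_le_of_mem_exS {r : ℕ} {q : ℚ} (hq : q ∈ exS r) : 1 ≤ q := by
  obtain ⟨m, j, α, -, -, rfl⟩ := hq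
  have h1 : (1 : ℚ) ≤ 2 ^ m := one_le_pow₀ (by norm_num)
  have h2 : (0 : ℚ) ≤ (α : ℚ) / 2 ^ ((m + 1) * r) := by positivity
  have h3 : (0 : ℚ) ≤ j := by positivity
  linarith

theorem exists_finset_subset_exS (r k : ℕ) :
    ∃ F : Finset ℚ, F.card = 2 ^ k * 2 ^ ((k + 1) * r) ∧
      ∀ q ∈ F, q ∈ exS r ∧ q < 2 ^ (k + 1) := by
  let N := 2 ^ ((k + 1) * r)
  have hN : (0 : ℚ) < 2 ^ ((k + 1) * r) := by positivity
  let g : ℕ × ℕ → ℚ := fun p => (2 ^ k + p.1 : ℚ) + (p.2 : ℚ) / 2 ^ ((k + 1) * r)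
  have hfrac {α : ℕ} (hα : α < N) : (α : ℚ) / 2 ^ ((k + 1) * r) < 1 := by
    rw [div_lt_one hN]
    exact_mod_cast hα
  have hfrac0 (α : ℕ) : (0 : ℚ) ≤ (α : ℚ) / 2 ^ ((k + 1) * r) := by positivity
  refine ⟨(Finset.range (2 ^ k) ×ˢ Finset.range N).image g, ?_, ?_⟩
  · rw [Finset.card_image_of_injOn, Finset.card_product, Finset.card_range, Finset.card_range]
    rintro ⟨j, α⟩ hp ⟨j', α'⟩ hp' he
    simp only [Finset.coe_product, Finset.coe_range, Set.mem_prod, Set.mem_Iio] at hp hp'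
    simp only [g] at he
    have h1 := hfrac hp.2
    have h2 := hfrac hp'.2
    have h3 := hfrac0 α
    have h4 := hfrac0 α'
    have hj : j = j' := by
      have h5 : (j : ℚ) < j' + 1 := by linarith
      have h6 : (j' : ℚ) < j + 1 := by linarith
      have h5' : j < j' + 1 := by exact_mod_cast h5
      have h6' : j' < j + 1 := by exact_mod_cast h6
      omega
    subst hj
    have := (div_left_inj' hN.ne').mp (add_left_cancel he)
    rw [Nat.cast_injective this]
  · intro q hq
    obtain ⟨⟨j, α⟩, hp, rfl⟩ := Finset.mem_image.mp hq
    simp only [Finset.mem_product, Finset.mem_range] at hp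
    refine ⟨⟨k, j, α, hp.1, hp.2, rfl⟩, ?_⟩
    have h1 := hfrac hp.2
    have h2 : (j : ℚ) + 1 ≤ 2 ^ k := by exact_mod_cast hp.1
    simp only [g]
    rw [pow_succ]
    linarith

namespace IsNonnegValuation

variable {R : Type*} [CommRing R] [IsLocalRing R] {v : R → ℚ ×ₗ ℚ} {r : ℕ}

theorem exists_map_eq_toLex_of_image_eq [IsDomain R] (h : IsNonnegValuation v)
    (hT : {γ | ∃ x ∈ maximalIdeal R, x ≠ 0 ∧ v x = γ} = exT r) (x : R) (hx : x ≠ 0) :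
    ∃ (k : ℕ) (b : ℚ), 0 ≤ b ∧ v x = toLex ((k : ℚ), b) := by
  by_cases hu : IsUnit x
  · exact ⟨0, 0, le_rfl, by simpa using! h.map_eq_zero_of_isUnit hu⟩
  · obtain ⟨k, q, hq, hk⟩ : v x ∈ exT r := hT ▸ ⟨x, (mem_maximalIdeal x).mpr hu, hx, rfl⟩
    exact ⟨k, _, div_nonneg (zero_le_one.trans (one_le_of_mem_exS hq)) (exc_pos k).le, hk⟩

theorem maximalIdeal_le_ideal_of_image_eq (h : IsNonnegValuation v)
    (hT : {γ | ∃ x ∈ maximalIdeal R, x ≠ 0 ∧ v x = γ} = exT r) :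
    maximalIdeal R ≤ h.ideal (toLex (0, 1)) := by
  intro x hxm hx
  obtain ⟨k, q, hq, hk⟩ : v x ∈ exT r := hT ▸ ⟨x, hxm, hx, rfl⟩
  rw [hk, Prod.Lex.toLex_le_toLex]
  rcases k.eq_zero_or_pos with rfl | hk0
  · exact Or.inr ⟨by simp, by simpa [exc] using one_le_of_mem_exS hq⟩
  · exact Or.inl (show (0 : ℚ) < k from Nat.cast_pos.mpr hk0)

theorem exists_two_pow_le_of_image_eq [IsDomain R] [IsNoetherianRing R]
    (h : IsNonnegValuation v)
    (hT : {γ | ∃ x ∈ maximalIdeal R, x ≠ 0 ∧ v x = γ} = exT r) {C d : ℕ}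
    (hC : ∀ n : ℕ, Module.length R (R ⧸ (h.ideal (toLex (1, 0)) ⊔ maximalIdeal R ^ n)) ≤
      (C * n ^ d : ℕ)) {m e : ℕ} (he : exc m = 2 ^ e) {L : ℕ} (f : Fin L → R)
    (hf : ∀ i, f i ∈ h.ideal (toLex ((m : ℚ), 0))) {a : R} (ha : a ∉ h.ideal (toLex (1, 0)))
    (haf : ∀ x ∈ h.ideal (toLex ((m : ℚ), 0)), a * x ∈ Ideal.span (Set.range f)) :
    ∃ N : ℕ, ∀ n ≥ N, 2 ^ (e + n) * 2 ^ ((e + n + 1) * r) ≤ L * C * 2 ^ d * 2 ^ ((n + 1) * d) := by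
  classical
  obtain ⟨c, hc⟩ := h.exists_card_le_mul_length (h.exists_map_eq_toLex_of_image_eq hT)
    (h.maximalIdeal_le_ideal_of_image_eq hT) m f hf ha haf
  refine ⟨c, fun n hn => ?_⟩
  obtain ⟨F, hF, hFS⟩ := exists_finset_subset_exS r (e + n)
  have hinj : Function.Injective fun q : ℚ => q / exc m := fun p q hpq =>
    (div_left_inj' (exc_pos m).ne').mp hpq
  have h1 := hc (2 ^ (n + 1)) (F.image fun q => q / exc m) fun t ht => by
    obtain ⟨q, hq, rfl⟩ := Finset.mem_image.mp ht
    obtain ⟨hqS, hqlt⟩ := hFS q hq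
    refine ⟨?_, ?_⟩
    · rw [div_lt_iff₀ (exc_pos m), he]
      push_cast
      rwa [← pow_add, add_comm (n + 1), ← add_assoc]
    · obtain ⟨x, -, hx, hv⟩ : toLex ((m : ℚ), q / exc m) ∈
          {γ | ∃ x ∈ maximalIdeal R, x ≠ 0 ∧ v x = γ} := hT ▸ ⟨m, q, hqS, rfl⟩
      exact ⟨x, hx, div_nonneg (zero_le_one.trans (one_le_of_mem_exS hqS)) (exc_pos m).le, hv⟩
  rw [Finset.card_image_of_injective _ hinj, hF] at h1
  have h2 : 2 ^ (e + n) * 2 ^ ((e + n + 1) * r) ≤ L * (C * (2 ^ (n + 1) + c) ^ d) := by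
    have := h1.trans (mul_le_mul_right (hC _) _)
    exact_mod_cast this
  have hc2 : c ≤ 2 ^ (n + 1) := hn.trans (n.lt_two_pow_self.le.trans
    (Nat.pow_le_pow_right two_pos n.le_succ))
  calc _ ≤ L * (C * (2 ^ (n + 1) + c) ^ d) := h2
    _ ≤ L * (C * (2 * 2 ^ (n + 1)) ^ d) := by
      gcongr
      omega
    _ = _ := by rw [mul_pow, ← pow_mul]; ring

theorem image_ne_exT [IsDomain R] [IsNoetherianRing R] (h : IsNonnegValuation v)
    (hdim : ringKrullDim R = (r + 2 : ℕ)) :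
    {γ | ∃ x ∈ maximalIdeal R, x ≠ 0 ∧ v x = γ} ≠ exT r := by
  intro hT
  have hlev := h.exists_map_eq_toLex_of_image_eq hT
  let P := h.ideal (toLex (1, 0))
  have hP : P.IsPrime := h.isPrime_ideal_one hlev
  have hPbot : P ≠ ⊥ := by
    have h1 : (1 : ℚ) ∈ exS r := ⟨0, 0, 0, by simp⟩
    obtain ⟨x, -, hx, hv⟩ : toLex (((1 : ℕ) : ℚ), 1 / exc 1) ∈
      {γ | ∃ x ∈ maximalIdeal R, x ≠ 0 ∧ v x = γ} := hT ▸ ⟨1, 1, h1, rfl⟩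
    refine fun hb => hx ((Submodule.eq_bot_iff _).mp hb x ?_)
    rw [h.mem_ideal_iff hx, hv, Prod.Lex.toLex_le_toLex]
    exact Or.inr ⟨by simp, by simp [exc]⟩
  have hdimbot : ringKrullDim (R ⧸ (⊥ : Ideal R)) = (r + 2 : ℕ) :=
    (ringKrullDim_eq_of_ringEquiv (RingEquiv.quotientBot R)).trans hdim
  have hdP := Ideal.ringKrullDim_quotient_add_one_le_of_lt (bot_lt_iff_ne_bot.mpr hPbot)
  rw [hdimbot] at hdP
  obtain ⟨d, hd⟩ : ∃ d : ℕ, ringKrullDim (R ⧸ P) = d := by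
    have hne : ringKrullDim (R ⧸ P) ≠ ⊥ := fun hb =>
      absurd (ringKrullDim_nonneg_of_nontrivial (R := R ⧸ P)) (by simp [hb])
    obtain ⟨d, hd⟩ := WithBot.ne_bot_iff_exists.mp hne
    rw [← hd] at hdP ⊢
    have hd' : d ≠ ⊤ := by
      rintro rfl
      have htop : ((⊤ : ℕ∞) + 1) ≤ ((r + 2 : ℕ) : ℕ∞) := WithBot.coe_le_coe.mp hdP
      rw [top_add, top_le_iff] at htop
      exact ENat.natCast_ne_top _ htop
    obtain ⟨d, rfl⟩ := ENat.ne_top_iff_exists.mp hd'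
    exact ⟨d, rfl⟩
  rw [hd] at hdP
  have hdr : d ≤ r + 1 := by
    have : d + 1 ≤ r + 2 := by exact_mod_cast hdP
    omega
  obtain ⟨C, hC⟩ := Ideal.IsPrime.exists_length_quotient_sup_pow_le P d hd
  have hrd : r + 1 ≤ d := by
    by_contra! hlt
    obtain ⟨N, hN⟩ := h.exists_two_pow_le_of_image_eq hT hC (m := 0) (e := 0) (by simp [exc])
      (fun _ : Fin 1 => (1 : R)) (fun _ h1 => by simpa using! h.nonneg 1 h1)
      ((Ideal.ne_top_iff_one P).mp hP.ne_top) (fun x _ => by simp)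
    set K := 1 * C * 2 ^ d
    have h1 := hN (N + K) (by omega)
    have h2 : 2 ^ ((N + K + 1) * d) ≤ 2 ^ ((0 + (N + K) + 1) * r) :=
      Nat.pow_le_pow_right two_pos (by rw [zero_add]; gcongr; omega)
    have h3 := Nat.le_of_mul_le_mul_right (h1.trans (mul_le_mul_right h2 _)) (by positivity)
    have h4 : N + K < 2 ^ (N + K) := Nat.lt_two_pow_self
    rw [zero_add] at h3
    omega
  have hmin (Q : Ideal R) (hQ : Q.IsPrime) (hQP : Q < P) : Q = ⊥ := by
    by_contra hQb
    have h1 := Ideal.ringKrullDim_quotient_add_one_le_of_lt hQP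
    have h2 := Ideal.ringKrullDim_quotient_add_one_le_of_lt (bot_lt_iff_ne_bot.mpr hQb)
    rw [hdimbot] at h2
    rw [hd] at h1
    have h3 : ((d : WithBot ℕ∞) + 1) + 1 ≤ (r + 2 : ℕ) := (add_le_add_left h1 1).trans h2
    have : d + 1 + 1 ≤ r + 2 := by exact_mod_cast h3
    omega
  obtain ⟨L, hL⟩ := Ideal.exists_forall_mul_mem_span_range P hPbot hmin
  set K := L * C * 2 ^ d with hK
  obtain ⟨f, hf, a, ha, haf⟩ := hL (h.ideal (toLex (((2 ^ (K + 1) : ℕ) : ℚ), 0)))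
  obtain ⟨N, hN⟩ := h.exists_two_pow_le_of_image_eq hT hC (m := 2 ^ (K + 1)) (e := K + 1)
    (by simp [exc]) f hf ha haf
  have h1 := hN N le_rfl
  rw [← hK, ← pow_add] at h1
  have h2 : 2 ^ K * 2 ^ ((N + 1) * d) ≤ 2 ^ (K + 1 + N + (K + 1 + N + 1) * r) := by
    rw [← pow_add]
    refine Nat.pow_le_pow_right two_pos ?_
    obtain rfl : d = r + 1 := le_antisymm hdr hrd
    nlinarith [Nat.zero_le (K * r)]
  have h3 := Nat.le_of_mul_le_mul_right (h2.trans h1) (by positivity)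
  exact absurd h3 (not_le.mpr Nat.lt_two_pow_self)

end IsNonnegValuation

/-- **Example 3.**  For `s ≥ 3` and `r = s - 2`, the semigroup `T` is not the
semigroup of values on `m_R∖{0}` of a valuation (with values in the lex-ordered group
`ℚ × ℚ`) dominating a noetherian local domain `R` of Krull dimension `s`:  for every such `R`
and `ν`, `ν(m_R∖{0}) ≠ T`. -/
theorem stmt8 (s : ℕ) (hs : 3 ≤ s)
    (R : Type*) [CommRing R] [IsDomain R] [IsNoetherianRing R] [IsLocalRing R]
    (hdim : ringKrullDim R = s)
    (K : Type*) [Field K] [Algebra R K] [IsFractionRing R K]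
    (ν : K → ℚ ×ₗ ℚ)
    (hmul : ∀ x y : K, x ≠ 0 → y ≠ 0 → ν (x * y) = ν x + ν y)
    (hadd : ∀ x y : K, x ≠ 0 → y ≠ 0 → x + y ≠ 0 → min (ν x) (ν y) ≤ ν (x + y))
    (hnonneg : ∀ x : R, x ≠ 0 → 0 ≤ ν (algebraMap R K x))
    (hdom : ∀ x : R, x ∈ IsLocalRing.maximalIdeal R → x ≠ 0 → 0 < ν (algebraMap R K x)) :
    {γ : ℚ ×ₗ ℚ | ∃ x : R, x ∈ IsLocalRing.maximalIdeal R ∧ x ≠ 0 ∧ ν (algebraMap R K x) = γ}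
      ≠ exT (s - 2) := by
  obtain ⟨r, rfl⟩ : ∃ r, s = r + 2 := ⟨s - 2, by omega⟩
  have hne {x : R} (hx : x ≠ 0) : algebraMap R K x ≠ 0 :=
    (map_ne_zero_iff _ (IsFractionRing.injective R K)).mpr hx
  have h : IsNonnegValuation fun x : R => ν (algebraMap R K x) :=
    { map_mul := fun x y hx hy => by rw [map_mul, hmul _ _ (hne hx) (hne hy)]
      min_le_map_add := fun x y hx hy hxy => by
        rw [map_add]
        exact hadd _ _ (hne hx) (hne hy) (map_add (algebraMap R K) x y ▸ hne hxy)
      nonneg := hnonneg }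
  exact h.image_ne_exT hdim
end
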